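/- arXiv:2511.05922 — 8 statements merged into one kernel-verified Lean document; each statement's English description precedes it below -/
import Mathlib

section
/- Let K be a rigid tensor-triangulated category equipped with a bounded, ⊗-compatible weight structure. Suppose given a set S = {x_i}_{i∈I} of objects of K such that: (i) each x_i lies in K^♥[−n_i] for some integer n_i; (ii) for every integer n, every object of K^♥[−n] is a finite coproduct of objects x_j with n_j = n; (iii) the tt-ideal ⟨x_i⟩ equals K for every i ∈ I; (iv) every finite subset {x_j}_{j∈J} ⊆ S with all n_j < 0 is strongly weight-nilpotent; (v) for every object a ∈ K and every integer m with a ∈ K^{≤m}, there is a distinguished triangle a_m → a → a' → a_m[1] with a_m ∈ K^♥[−m] and a' ∈ K^{≤m−1} such that the connecting morphism a' → a_m[1] factors through an object of K^{≤m−2}. Then for every object a of K not isomorphic to 0, the tt-ideal generated by a is all of K; consequently every prime tt-ideal of K is the zero ideal, i.e. the Balmer spectrum of K has at most one point, namely (0). -/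
open CategoryTheory CategoryTheory.Limits CategoryTheory.Pretriangulated
  CategoryTheory.MonoidalCategory

universe v u w

variable (C : Type u) [Category.{v} C] [HasZeroObject C] [Preadditive C] [HasShift C ℤ]
  [∀ n : ℤ, (shiftFunctor C n).Additive] [Pretriangulated C] [MonoidalCategory C]

section Defs

/-- The tensor product `X 0 ⊗ X 1 ⊗ ⋯ ⊗ X (m-1)` of a finite family of objects
(the empty tensor product being the monoidal unit). -/
def tensorFam : ∀ {m : ℕ}, (Fin m → C) → C
  | 0, _ => 𝟙_ C
  | m + 1, X => tensorFam (fun k : Fin m => X k.castSucc) ⊗ X (Fin.last m)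

/-- A weight structure on a triangulated category `C`: collections `LE n` (rendering
`C^{≤n} := C^{≤0}[−n]`) and `GE n` (rendering `C^{≥n} := C^{≥0}[−n]`), each closed under
isomorphisms and direct summands, compatible with shifts, with `C^{≤0} ⊆ C^{≤1}`,
`C^{≥1} ⊆ C^{≥0}`, no morphisms from `C^{≥1}` to `C^{≤0}`, and weight decompositions. -/
structure WeightStructure where
  LE : ℤ → C → Prop
  GE : ℤ → C → Prop
  isoClosed_LE : ∀ (n : ℤ) {X Y : C}, (X ≅ Y) → LE n X → LE n Y
  isoClosed_GE : ∀ (n : ℤ) {X Y : C}, (X ≅ Y) → GE n X → GE n Y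
  summand_LE : ∀ (n : ℤ) {X Y : C}, LE n Y → ∀ (i : X ⟶ Y) (r : Y ⟶ X), i ≫ r = 𝟙 X → LE n X
  summand_GE : ∀ (n : ℤ) {X Y : C}, GE n Y → ∀ (i : X ⟶ Y) (r : Y ⟶ X), i ≫ r = 𝟙 X → GE n X
  shift_LE : ∀ (n a : ℤ) (X : C), LE n X → LE (n - a) (X⟦a⟧)
  shift_GE : ∀ (n a : ℤ) (X : C), GE n X → GE (n - a) (X⟦a⟧)
  mono_LE : ∀ (n : ℤ) (X : C), LE n X → LE (n + 1) X
  anti_GE : ∀ (n : ℤ) (X : C), GE n X → GE (n - 1) X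
  orth : ∀ {X Y : C}, GE 1 X → LE 0 Y → ∀ f : X ⟶ Y, f = 0
  decomp : ∀ X : C, ∃ (A B : C) (f : A ⟶ X) (g : X ⟶ B) (h : B ⟶ A⟦(1 : ℤ)⟧),
    (Triangle.mk f g h ∈ distTriang C) ∧ GE 1 A ∧ LE 0 B

/-- A tt-ideal of a tensor-triangulated category, rendered as a predicate on objects:
it contains the zero objects, is closed under isomorphisms, shifts, cones, direct
summands, and tensoring with arbitrary objects. -/
structure IsTTIdeal (P : C → Prop) : Prop where
  zero : ∀ X : C, IsZero X → P X
  isoClosed : ∀ {X Y : C}, (X ≅ Y) → P X → P Y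
  shift : ∀ (X : C) (n : ℤ), P X → P (X⟦n⟧)
  ext : ∀ T ∈ distTriang C, P T.obj₁ → P T.obj₂ → P T.obj₃
  summand : ∀ {X Y : C}, P Y → ∀ (i : X ⟶ Y) (r : Y ⟶ X), i ≫ r = 𝟙 X → P X
  tensorClosed : ∀ (X Y : C), P X → P (X ⊗ Y)
  tensorClosed' : ∀ (X Y : C), P X → P (Y ⊗ X)

/-- `X` belongs to the tt-ideal generated by the collection `S` of objects. -/
def InTTIdealGen (S : Set C) (X : C) : Prop :=
  ∀ P : C → Prop, IsTTIdeal C P → (∀ s ∈ S, P s) → P X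

/-- A finite family `y 0, …, y (m-1)` of objects is strongly weight-nilpotent if there is
some `n ≥ 1` such that `Hom(y (ψ 1) ⊗ ⋯ ⊗ y (ψ n), 𝟙) = 0` for all
`ψ : {1, …, n} → {0, …, m-1}`. -/
def StronglyWeightNilpotent {m : ℕ} (y : Fin m → C) : Prop :=
  ∃ n : ℕ, 1 ≤ n ∧ ∀ ψ : Fin n → Fin m,
    ∀ f : tensorFam C (fun k => y (ψ k)) ⟶ 𝟙_ C, f = 0

end Defs

section Helpers

set_option linter.unusedSectionVars false

variable {C}

section Unbundled

variable {X Y Z A X' Y' Z' : C} {f : X ⟶ Y} {g : Y ⟶ Z} {h : Z ⟶ X⟦(1 : ℤ)⟧}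
  {f' : X' ⟶ Y'} {g' : Y' ⟶ Z'} {h' : Z' ⟶ X'⟦(1 : ℤ)⟧}

lemma tri_coyo₂ (H : Triangle.mk f g h ∈ distTriang C) (t : A ⟶ Y) (ht : t ≫ g = 0) :
    ∃ s : A ⟶ X, t = s ≫ f := Triangle.coyoneda_exact₂ _ H t ht

lemma tri_coyo₁ (H : Triangle.mk f g h ∈ distTriang C) (t : A ⟶ X⟦(1 : ℤ)⟧)
    (ht : t ≫ f⟦(1 : ℤ)⟧' = 0) :
    ∃ s : A ⟶ Z, t = s ≫ h := Triangle.coyoneda_exact₁ _ H t ht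

lemma tri_yo₂ (H : Triangle.mk f g h ∈ distTriang C) (t : Y ⟶ A) (ht : f ≫ t = 0) :
    ∃ s : Z ⟶ A, t = g ≫ s := Triangle.yoneda_exact₂ _ H t ht

lemma tri_compl₂ (H : Triangle.mk f g h ∈ distTriang C) (H' : Triangle.mk f' g' h' ∈ distTriang C)
    (a : X ⟶ X') (c : Z ⟶ Z') (comm : h ≫ a⟦(1 : ℤ)⟧' = c ≫ h') :
    ∃ b : Y ⟶ Y', f ≫ b = a ≫ f' ∧ g ≫ c = b ≫ g' :=
  complete_distinguished_triangle_morphism₂ _ _ H H' a c comm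

lemma tri_compl₁ (H : Triangle.mk f g h ∈ distTriang C) (H' : Triangle.mk f' g' h' ∈ distTriang C)
    (b : Y ⟶ Y') (c : Z ⟶ Z') (comm : g ≫ c = b ≫ g') :
    ∃ a : X ⟶ X', f ≫ b = a ≫ f' :=
  (complete_distinguished_triangle_morphism₁ _ _ H H' b c comm).imp fun _ h => h.1

lemma tri_zero₁₂ (H : Triangle.mk f g h ∈ distTriang C) : f ≫ g = 0 :=
  comp_distTriang_mor_zero₁₂ _ H

lemma tri_zero₃₁ (H : Triangle.mk f g h ∈ distTriang C) : h ≫ f⟦(1 : ℤ)⟧' = 0 :=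
  comp_distTriang_mor_zero₃₁ _ H

lemma tri_iso (H : Triangle.mk f g h ∈ distTriang C) (e : Y ≅ Y') :
    Triangle.mk (f ≫ e.hom) (e.inv ≫ g) h ∈ distTriang C := by
  refine isomorphic_distinguished _ H _ (Triangle.isoMk _ _ (Iso.refl X) e.symm (Iso.refl Z) ?_ ?_ ?_)
  · change (f ≫ e.hom) ≫ e.inv = 𝟙 X ≫ f
    simp
  · change (e.inv ≫ g) ≫ 𝟙 Z = e.inv ≫ g
    simp
  · change h ≫ (𝟙 X)⟦(1 : ℤ)⟧' = 𝟙 Z ≫ h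
    simp

end Unbundled

/-- composition of maps with cones in an extension closed class, without octahedra -/
theorem comp_fiber {y2 y1 y E E2 : C} {k : y2 ⟶ y1} {e2 : y1 ⟶ E2} {δ2 : E2 ⟶ y2⟦(1 : ℤ)⟧}
    {h : y1 ⟶ y} {e : y ⟶ E} {δ : E ⟶ y1⟦(1 : ℤ)⟧}
    (H2 : Triangle.mk k e2 δ2 ∈ distTriang C) (H : Triangle.mk h e δ ∈ distTriang C) :
    ∃ (F G : C) (i : E2 ⟶ F) (p : F ⟶ E) (d : E ⟶ E2⟦(1 : ℤ)⟧) (t : G ⟶ y) (b : y ⟶ F)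
      (c : F ⟶ G⟦(1 : ℤ)⟧) (r : G ⟶ y2), Triangle.mk i p d ∈ distTriang C ∧
      Triangle.mk t b c ∈ distTriang C ∧ t = r ≫ k ≫ h := by
  obtain ⟨F, i, p, HF⟩ := distinguished_cocone_triangle₂ (δ ≫ e2⟦(1 : ℤ)⟧')
  obtain ⟨b, hb1, hb2⟩ := tri_compl₂ H HF e2 (𝟙 E) (by simp)
  obtain ⟨G, t, c, HG⟩ := distinguished_cocone_triangle₁ b
  change h ≫ b = e2 ≫ i at hb1
  change e ≫ 𝟙 E = b ≫ p at hb2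
  rw [Category.comp_id] at hb2
  have htb : t ≫ b = 0 := tri_zero₁₂ HG
  obtain ⟨r, hr⟩ := tri_coyo₂ H t (by
    change t ≫ e = 0
    rw [hb2, reassoc_of% htb, zero_comp])
  change t = r ≫ h at hr
  have h0 : (r ≫ e2) ≫ i = 0 := by
    rw [Category.assoc, ← hb1, ← Category.assoc, ← hr, htb]
  obtain ⟨s, hs⟩ := tri_coyo₁ HF ((r ≫ e2)⟦(1 : ℤ)⟧') (by
    change _ ≫ i⟦(1 : ℤ)⟧' = 0
    rw [← Functor.map_comp, h0, Functor.map_zero])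
  change _ = s ≫ δ ≫ e2⟦(1 : ℤ)⟧' at hs
  have hδ : δ ≫ h⟦(1 : ℤ)⟧' = 0 := tri_zero₃₁ H
  obtain ⟨u, hu⟩ := (shiftFunctor C (1 : ℤ)).map_surjective (s ≫ δ)
  have hu1 : u ≫ h = 0 := by
    apply (shiftFunctor C (1 : ℤ)).map_injective
    rw [Functor.map_comp, hu, Category.assoc, hδ, comp_zero, Functor.map_zero]
  have hu2 : u ≫ e2 = r ≫ e2 := by
    apply (shiftFunctor C (1 : ℤ)).map_injective
    rw [Functor.map_comp, hu, Category.assoc, hs]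
  obtain ⟨r', hr'⟩ := tri_coyo₂ H2 (r - u) (by
    change (r - u) ≫ e2 = 0
    rw [Preadditive.sub_comp, hu2, sub_self])
  change r - u = r' ≫ k at hr'
  refine ⟨F, G, i, p, _, t, b, c, r', HF, HG, ?_⟩
  rw [← Category.assoc, ← hr', Preadditive.sub_comp, hu1, sub_zero, hr]

/-- `f` is dominated by a map with cone in `P` -/
def Dom (P : C → Prop) {X Y : C} (f : X ⟶ Y) : Prop :=
  ∃ (G E : C) (t : G ⟶ Y) (e : Y ⟶ E) (δ : E ⟶ G⟦(1 : ℤ)⟧),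
    Triangle.mk t e δ ∈ distTriang C ∧ P E ∧ ∃ r : G ⟶ X, t = r ≫ f

lemma IsTTIdeal.ext₂ {P : C → Prop} (hP : IsTTIdeal C P) (T : Triangle C)
    (hT : T ∈ distTriang C) (h1 : P T.obj₁) (h3 : P T.obj₃) : P T.obj₂ :=
  hP.ext _ (inv_rot_of_distTriang _ hT) (hP.shift _ _ h3) h1

lemma Dom.of_comp {P : C → Prop} {X Y Z : C} {f : X ⟶ Y} {g : Y ⟶ Z} (h : Dom P (f ≫ g)) :
    Dom P g := by
  obtain ⟨G, E, t, e, δ, H, hE, r, hr⟩ := h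
  exact ⟨G, E, t, e, δ, H, hE, r ≫ f, by simp [hr]⟩

lemma Dom.precomp_iso {P : C → Prop} {X Y Z : C} (f : X ≅ Y) {g : Y ⟶ Z} (h : Dom P g) :
    Dom P (f.hom ≫ g) := by
  obtain ⟨G, E, t, e, δ, H, hE, r, hr⟩ := h
  exact ⟨G, E, t, e, δ, H, hE, r ≫ f.inv, by simp [hr]⟩

lemma Dom.comp {P : C → Prop} (hP : IsTTIdeal C P) {X Y Z : C} {f : X ⟶ Y} {g : Y ⟶ Z}
    (hf : Dom P f) (hg : Dom P g) : Dom P (f ≫ g) := by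
  obtain ⟨G, E, t, e, δ, H, hE, r, hr⟩ := hf
  obtain ⟨G', E', t', e', δ', H', hE', r', hr'⟩ := hg
  obtain ⟨Q, k, δ2, HQ⟩ := distinguished_cocone_triangle₁ (r' ≫ e)
  obtain ⟨a, ha⟩ := tri_compl₁ HQ H r' (𝟙 E) (by simp)
  change k ≫ r' = a ≫ t at ha
  obtain ⟨F, G2, i, p, d, t2, b, c, r2, HF, HG, h2⟩ := comp_fiber HQ H'
  refine ⟨G2, F, t2, b, c, HG, hP.ext₂ _ HF hE hE', r2 ≫ a ≫ r, ?_⟩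
  rw [h2, hr', reassoc_of% ha, hr]
  simp

lemma Dom.postcomp_iso {P : C → Prop} (hP : IsTTIdeal C P) {X Y Z : C} {f : X ⟶ Y} (g : Y ≅ Z)
    (h : Dom P f) : Dom P (f ≫ g.hom) := by
  refine h.comp hP ⟨Y, _, 𝟙 Y ≫ g.hom, _, _, tri_iso (contractible_distinguished Y) g,
    hP.zero _ (isZero_zero C), 𝟙 _, by simp⟩

lemma Dom.zero {P : C → Prop} (hP : IsTTIdeal C P) {X Y : C} (h : Dom P (0 : X ⟶ Y)) : P Y := by
  obtain ⟨G, E, t, e, δ, H, hE, r, hr⟩ := h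
  rw [comp_zero] at hr
  obtain ⟨s, hs⟩ := tri_yo₂ H (𝟙 Y) (by
    change t ≫ 𝟙 Y = 0
    simp [hr])
  exact hP.summand hE e s hs.symm

/-- Classes closed under extensions and finite sub-sums. -/
structure ExtClosed (R : C → Prop) : Prop where
  ext : ∀ T ∈ distTriang C, R T.obj₁ → R T.obj₃ → R T.obj₂
  sum : ∀ (k : ℕ) (B : Fin k → C) (A : C) (p : ∀ j, A ⟶ B j) (i : ∀ j, B j ⟶ A),
    ∑ j, p j ≫ i j = 𝟙 A → (∀ j, R (B j)) → R A

lemma ExtClosed.iso {R : C → Prop} (hR : ExtClosed R) {X Y : C} (e : X ≅ Y) (h : R X) : R Y :=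
  hR.sum 1 (fun _ => X) Y (fun _ => e.inv) (fun _ => e.hom) (by simp) (fun _ => h)

lemma extClosed_hom (Z : C) : ExtClosed (fun A : C => ∀ f : A ⟶ Z, f = 0) where
  ext T hT h1 h3 f := by
    obtain ⟨g, hg⟩ := Triangle.yoneda_exact₂ _ hT f (h1 _)
    rw [hg, h3 g, comp_zero]
  sum k B A p i h hB f := by
    rw [← Category.id_comp f, ← h, Preadditive.sum_comp]
    exact Finset.sum_eq_zero fun j _ => by rw [Category.assoc, hB j (i j ≫ f), comp_zero]

section Tensor

variable [∀ X : C, (tensorLeft X).CommShift ℤ] [∀ X : C, (tensorLeft X).IsTriangulated]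

lemma Dom.tensor {P : C → Prop} (hP : IsTTIdeal C P) {X Y : C} {f : X ⟶ Y} (W : C)
    (h : Dom P f) : Dom P (W ◁ f) := by
  obtain ⟨G, E, t, e, δ, H, hE, r, hr⟩ := h
  have := (tensorLeft W).map_distinguished _ H
  exact ⟨W ⊗ G, W ⊗ E, W ◁ t, W ◁ e, _, this, hP.tensorClosed' _ _ hE, W ◁ r, by simp [hr]⟩

lemma zero_whisker [BraidedCategory C] (X Y W : C) : (0 : X ⟶ Y) ▷ W = 0 := by
  have h : W ◁ (0 : X ⟶ Y) = 0 := (tensorLeft W).map_zero X Y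
  rw [← cancel_mono (β_ Y W).hom, BraidedCategory.braiding_naturality_left, h]
  simp

lemma Dom.pow_step {P : C → Prop} (hP : IsTTIdeal C P) {W y T : C} {v : W ⟶ 𝟙_ C}
    (h : Dom P (v ▷ y)) {vn : T ⟶ 𝟙_ C} (hn : Dom P (vn ▷ y)) :
    Dom P (((T ◁ v ≫ (ρ_ T).hom) ≫ vn) ▷ y) := by
  have h1 : Dom P ((T ◁ v) ▷ y) := by
    have := ((h.tensor hP T).precomp_iso (α_ T W y)).postcomp_iso hP (α_ T (𝟙_ C) y).symm
    simpa using this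
  have h2 := (h1.postcomp_iso hP (whiskerRightIso (ρ_ T) y)).comp hP hn
  rw [comp_whiskerRight, comp_whiskerRight]
  exact h2

lemma Dom.pow_zero {P : C → Prop} {W y : C} {v : W ⟶ 𝟙_ C}
    (h : Dom P (v ▷ y)) : Dom P (𝟙 (𝟙_ C) ▷ y) :=
  Dom.of_comp (P := P) (f := v ▷ y) (by simpa using h)

/-- tensor power of a map to the unit -/
lemma Dom.pow {P : C → Prop} (hP : IsTTIdeal C P) {W y : C} {v : W ⟶ 𝟙_ C}
    (h : Dom P (v ▷ y)) (n : ℕ) :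
    ∃ vn : tensorFam C (fun _ : Fin n => W) ⟶ 𝟙_ C, Dom P (vn ▷ y) := by
  induction n with
  | zero => exact ⟨𝟙 (𝟙_ C), h.pow_zero⟩
  | succ n ih =>
    obtain ⟨vn, hn⟩ := ih
    exact ⟨_, Dom.pow_step hP h hn⟩

lemma ExtClosed.whL {R : C → Prop} (hR : ExtClosed R) (Y : C) :
    ExtClosed (fun A => R (Y ⊗ A)) where
  ext T hT h1 h3 := hR.ext _ ((tensorLeft Y).map_distinguished _ hT)
    h1 h3
  sum k B A p i h hB := by
    refine hR.sum k _ _ (fun j => Y ◁ p j) (fun j => Y ◁ i j) ?_ hB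
    have := congrArg (tensorLeft Y).map h
    rw [Functor.map_sum] at this
    simpa using this

lemma ExtClosed.whR [BraidedCategory C] {R : C → Prop} (hR : ExtClosed R) (Y : C) :
    ExtClosed (fun A => R (A ⊗ Y)) := by
  have : (fun A => R (A ⊗ Y)) = (fun A => R (Y ⊗ A)) := by
    funext A
    exact propext ⟨hR.iso (β_ _ _), hR.iso (β_ _ _)⟩
  rw [this]
  exact hR.whL Y

lemma tensorFam_mem [BraidedCategory C] {k : ℕ} (y : Fin k → C) (W : C)
    (hW : ∀ R : C → Prop, ExtClosed R → (∀ j, R (y j)) → R W) (n : ℕ) :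
    ∀ R : C → Prop, ExtClosed R → (∀ ψ : Fin n → Fin k, R (tensorFam C (fun j => y (ψ j)))) →
      R (tensorFam C (fun _ : Fin n => W)) := by
  induction n with
  | zero => exact fun R _ h => h Fin.elim0
  | succ n ih =>
    intro R hR h
    refine hW _ (hR.whL _) fun j => ?_
    refine ih _ (hR.whR (y j)) fun ψ => ?_
    have := h (Fin.snoc ψ j)
    simpa [tensorFam] using this

end Tensor

section Weight

variable (w : WeightStructure C)

lemma WeightStructure.orth' {n : ℤ} {X Y : C} (hX : w.GE n X) (hY : w.LE (n - 1) Y)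
    (f : X ⟶ Y) : f = 0 := by
  apply (shiftFunctor C (n - 1)).map_injective
  rw [Functor.map_zero]
  have h1 := w.shift_GE n (n - 1) X hX
  have h2 := w.shift_LE (n - 1) (n - 1) Y hY
  rw [sub_sub_cancel] at h1
  rw [sub_self] at h2
  exact w.orth h1 h2 _

lemma WeightStructure.decomp' (n : ℤ) (X : C) :
    ∃ (A B : C) (f : A ⟶ X) (g : X ⟶ B) (h : B ⟶ A⟦(1 : ℤ)⟧),
    (Triangle.mk f g h ∈ distTriang C) ∧ w.GE n A ∧ w.LE (n - 1) B := by
  obtain ⟨A, B, f, g, h, H, hA, hB⟩ := w.decomp (X⟦n - 1⟧)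
  let e : X⟦n - 1⟧⟦-(n - 1)⟧ ≅ X := (shiftShiftNeg X (n - 1))
  have H' := Triangle.shift_distinguished _ H (-(n - 1))
  have hA' := w.shift_GE _ (-(n - 1)) _ hA
  have hB' := w.shift_LE _ (-(n - 1)) _ hB
  rw [show (1 : ℤ) - -(n - 1) = n by ring] at hA'
  rw [show (0 : ℤ) - -(n - 1) = n - 1 by ring] at hB'
  let T := (Triangle.shiftFunctor C (-(n - 1))).obj (Triangle.mk f g h)
  refine ⟨T.obj₁, T.obj₃, T.mor₁ ≫ e.hom, e.inv ≫ T.mor₂, T.mor₃, ?_, hA', hB'⟩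
  exact tri_iso (f := T.mor₁) (g := T.mor₂) (h := T.mor₃) H' e

lemma WeightStructure.GE_of {n : ℤ} {X : C} (h : ∀ Y, w.LE (n - 1) Y → ∀ f : X ⟶ Y, f = 0) :
    w.GE n X := by
  obtain ⟨A, B, f, g, d, H, hA, hB⟩ := w.decomp' n X
  obtain ⟨s, hs⟩ := tri_coyo₂ H (𝟙 X) (h B hB _)
  exact w.summand_GE n hA s f hs.symm

lemma WeightStructure.LE_of {n : ℤ} {Y : C} (h : ∀ X, w.GE (n + 1) X → ∀ f : X ⟶ Y, f = 0) :
    w.LE n Y := by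
  obtain ⟨A, B, f, g, d, H, hA, hB⟩ := w.decomp' (n + 1) Y
  rw [add_sub_cancel_right] at hB
  obtain ⟨s, hs⟩ := tri_yo₂ H (𝟙 Y) (by
    change f ≫ 𝟙 Y = 0
    rw [h A hA f, zero_comp])
  exact w.summand_LE n hB g s hs.symm

lemma WeightStructure.LE_le {m n : ℤ} (hmn : m ≤ n) {X : C} (h : w.LE m X) : w.LE n X := by
  induction n, hmn using Int.leInduction with
  | base => exact h
  | succ n _ ih => exact w.mono_LE n X ih

lemma WeightStructure.GE_ge {m n : ℤ} (hmn : m ≤ n) {X : C} (h : w.GE n X) : w.GE m X :=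
  w.GE_of fun _ hY _ => w.orth' h (w.LE_le (by lia) hY) _

lemma WeightStructure.GE_ext {n : ℤ} (T : Triangle C) (hT : T ∈ distTriang C)
    (h1 : w.GE n T.obj₁) (h3 : w.GE n T.obj₃) : w.GE n T.obj₂ :=
  w.GE_of fun _ hY f => (extClosed_hom _).ext T hT (fun _ => w.orth' h1 hY _)
    (fun _ => w.orth' h3 hY _) f

lemma WeightStructure.isZero {n : ℤ} {X : C} (h : w.GE n X) (hle : w.LE (n - 1) X) : IsZero X :=
  (IsZero.iff_id_eq_zero X).2 (w.orth' h hle _)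

/-- Negative objects are extensions of finitely many generators -/
lemma exists_family {ι : Type*} (x : ι → C) (nwt : ι → ℤ)
    (hheart : ∀ (m : ℤ) (X : C), w.LE m X → w.GE m X →
      ∃ (k : ℕ) (g : Fin k → ι), (∀ j, nwt (g j) = m) ∧
        Nonempty (X ≅ ⨁ fun j => x (g j)))
    (hdecomp : ∀ (a : C) (m : ℤ), w.LE m a →
      ∃ (am a' : C) (f : am ⟶ a) (g : a ⟶ a') (h : a' ⟶ am⟦(1 : ℤ)⟧),
        (Triangle.mk f g h ∈ distTriang C) ∧ w.LE m am ∧ w.GE m am ∧ w.LE (m - 1) a')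
    (c : ℤ) (N : ℕ) : ∀ (m : ℤ) (a : C), m < 0 → m - c < N → w.LE m a → w.GE c a →
      ∃ L : Set ι, L.Finite ∧ (∀ i ∈ L, nwt i < 0) ∧
        ∀ R : C → Prop, ExtClosed R → (∀ i ∈ L, R (x i)) → R a := by
  have pure : ∀ (m : ℤ) (a : C), m < 0 → w.LE m a → w.GE m a →
      ∃ L : Set ι, L.Finite ∧ (∀ i ∈ L, nwt i < 0) ∧
        ∀ R : C → Prop, ExtClosed R → (∀ i ∈ L, R (x i)) → R a := by
    intro m a hm h1 h2
    obtain ⟨k, g, hg, ⟨e⟩⟩ := hheart m a h1 h2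
    refine ⟨Set.range g, Set.finite_range g, ?_, ?_⟩
    · rintro _ ⟨j, rfl⟩
      rw [hg]; exact hm
    · intro R hR h
      refine hR.iso e.symm (hR.sum k _ _ (fun j => biproduct.π _ j) 
        (fun j => biproduct.ι (fun j => x (g j)) j)
        biproduct.total fun j => h _ ⟨j, rfl⟩)
  induction N with
  | zero =>
    intro m a hm hc h1 h2
    push_cast at hc
    have : IsZero a := w.isZero h2 (w.LE_le (by lia) h1)
    refine ⟨∅, Set.finite_empty, by simp, fun R hR _ => ?_⟩
    exact hR.sum 0 Fin.elim0 a (fun j => j.elim0) (fun j => j.elim0) (this.eq_of_src _ _)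
      (fun j => j.elim0)
  | succ N ih =>
    intro m a hm hc h1 h2
    push_cast at hc
    by_cases hmc : m ≤ c
    · exact pure m a hm h1 (w.GE_ge hmc h2)
    obtain ⟨am, a', f, g, h, H, ham, ham', ha'⟩ := hdecomp a m h1
    have hga : w.GE c a' := w.GE_ext _ (rot_of_distTriang _ H) h2
      (w.GE_ge (by lia) (w.shift_GE _ 1 _ ham'))
    obtain ⟨L, hL, hL', hLR⟩ := ih (m - 1) a' (by lia) (by lia) ha' hga
    obtain ⟨L2, hL2, hL2', hLR2⟩ := pure m am hm ham ham'
    refine ⟨L ∪ L2, hL.union hL2, ?_, ?_⟩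
    · rintro i (hi | hi)
      exacts [hL' i hi, hL2' i hi]
    · intro R hR hx
      exact hR.ext _ H (hLR2 R hR fun i hi => hx i (Or.inr hi))
        (hLR R hR fun i hi => hx i (Or.inl hi))

end Weight

end Helpers

/-- Let `K` be a rigid tensor-triangulated category equipped with a bounded,
`⊗`-compatible weight structure. Suppose given a set `S = {x_i}_{i∈I}` of objects of `K`
such that: (i) each `x_i` lies in `K^♥[−n_i]` for some integer `n_i`; (ii) for every
integer `m`, every object of `K^♥[−m]` is a finite coproduct of objects `x_j` with
`n_j = m`; (iii) the tt-ideal `⟨x_i⟩` equals `K` for every `i ∈ I`; (iv) every finite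
subset `{x_j}_{j∈J} ⊆ S` with all `n_j < 0` is strongly weight-nilpotent; (v) for every
object `a ∈ K` and every integer `m` with `a ∈ K^{≤m}`, there is a distinguished triangle
`a_m → a → a' → a_m[1]` with `a_m ∈ K^♥[−m]` and `a' ∈ K^{≤m−1}` such that the connecting
morphism `a' → a_m[1]` factors through an object of `K^{≤m−2}`. Then for every object `a`
of `K` not isomorphic to `0`, the tt-ideal generated by `a` is all of `K`; consequently
every prime tt-ideal of `K` is the zero ideal: the Balmer spectrum has at most one point,
namely `(0)`. -/
theorem stmt0 [SymmetricCategory C] [RigidCategory C] [HasFiniteBiproducts C]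
    [∀ X : C, (tensorLeft X).CommShift ℤ] [∀ X : C, (tensorLeft X).IsTriangulated]
    (w : WeightStructure C)
    (hbounded : ∀ X : C, ∃ a b : ℤ, w.GE a X ∧ w.LE b X)
    -- ⊗-compatibility of the weight structure
    (hunit : w.LE 0 (𝟙_ C) ∧ w.GE 0 (𝟙_ C))
    (htensor_LE : ∀ (a b : ℤ) (X Y : C), w.LE a X → w.LE b Y → w.LE (a + b) (X ⊗ Y))
    (htensor_GE : ∀ (a b : ℤ) (X Y : C), w.GE a X → w.GE b Y → w.GE (a + b) (X ⊗ Y))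
    (hdual : ∀ (a : ℤ) (X : C), w.LE a X → w.GE (-a) (Xᘁ))
    -- the generators
    {ι : Type w} (x : ι → C) (nwt : ι → ℤ)
    -- (i) each generator is pure of a single weight
    (hpure : ∀ i, w.LE (nwt i) (x i) ∧ w.GE (nwt i) (x i))
    -- (ii) every object of `K^♥[−m]` is a finite coproduct of generators of weight `m`
    (hheart : ∀ (m : ℤ) (X : C), w.LE m X → w.GE m X →
      ∃ (k : ℕ) (g : Fin k → ι), (∀ j, nwt (g j) = m) ∧
        Nonempty (X ≅ ⨁ fun j => x (g j)))
    -- (iii) each generator generates `K` as a tt-ideal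
    (hgen : ∀ (i : ι) (X : C), InTTIdealGen C {x i} X)
    -- (iv) finite families of generators of negative weights are strongly weight-nilpotent
    (hnilp : ∀ (k : ℕ) (g : Fin k → ι), (∀ j, nwt (g j) < 0) →
      StronglyWeightNilpotent C (fun j => x (g j)))
    -- (v) weight decompositions with top weight piece split off and connecting morphism
    -- factoring two weights down
    (hdecomp : ∀ (a : C) (m : ℤ), w.LE m a →
      ∃ (am a' : C) (f : am ⟶ a) (g : a ⟶ a') (h : a' ⟶ am⟦(1 : ℤ)⟧),
        (Triangle.mk f g h ∈ distTriang C) ∧ w.LE m am ∧ w.GE m am ∧ w.LE (m - 1) a' ∧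
        ∃ (z : C) (p : a' ⟶ z) (q : z ⟶ am⟦(1 : ℤ)⟧), w.LE (m - 2) z ∧ h = p ≫ q) :
    (∀ a : C, ¬ IsZero a → ∀ X : C, InTTIdealGen C {a} X) ∧
    (∀ P : C → Prop, IsTTIdeal C P → (∃ X, ¬ P X) →
      (∀ X Y : C, P (X ⊗ Y) → P X ∨ P Y) → ∀ X : C, P X ↔ IsZero X) := by
  have main : ∀ a : C, ¬ IsZero a → ∀ P : C → Prop, IsTTIdeal C P → P a → ∀ X, P X := by
    intro a ha P hP hPa X
    obtain ⟨c, b, hc, hb⟩ := hbounded a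
    obtain ⟨m, hm, hmin⟩ := Int.exists_least_of_bdd (P := fun m => w.LE m a)
      ⟨c, fun z hz => by
        by_contra hlt
        exact ha (w.isZero hc (w.LE_le (by lia) hz))⟩ ⟨b, hb⟩
    obtain ⟨am, a', f, g, h, H, ham, ham', ha', z, p, q, hz, hpq⟩ := hdecomp a m hm
    have hnz : ¬ IsZero am := by
      intro h0
      have : IsIso g := (Triangle.isZero₁_iff_isIso₂ _ H).1 h0
      have := hmin _ (w.isoClosed_LE _ (asIso g).symm ha')
      lia
    suffices hPam : P am by
      obtain ⟨k, gg, -, ⟨e⟩⟩ := hheart m am ham ham'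
      by_cases hk : k = 0
      · subst hk
        refine absurd ?_ hnz
        refine IsZero.of_iso ?_ e
        rw [IsZero.iff_id_eq_zero]
        ext j
        exact j.elim0
      · have j : Fin k := ⟨0, Nat.pos_of_ne_zero hk⟩
        refine hgen (gg j) X P hP ?_
        rintro _ rfl
        exact hP.summand (hP.isoClosed e hPam) (biproduct.ι (fun j => x (gg j)) j)
          (biproduct.π _ j) (by simp)
    have hDh : Dom P h := ⟨a', _, h, _, _, rot_of_distTriang _ (rot_of_distTriang _ H),
      hP.shift _ _ hPa, 𝟙 _, by simp⟩
    suffices hPy : ∀ (y : C) (q : z ⟶ y), w.GE (m - 1) y → Dom P q → P y by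
      rw [hpq] at hDh
      exact hP.isoClosed (shiftShiftNeg am (1 : ℤ))
        (hP.shift _ (-1) (hPy _ q (w.shift_GE _ _ _ ham') hDh.of_comp))
    clear hDh hpq
    intro y q hyGE hDq
    have hdy : w.LE (-(m - 1)) (yᘁ) := by
      refine w.LE_of fun Z hZ f => ?_
      have hZy : w.GE (1 : ℤ) (Z ⊗ y) := by
        have := htensor_GE _ _ _ _ hZ hyGE
        rwa [show -(m - 1) + 1 + (m - 1) = 1 by ring] at this
      rw [← cancel_mono (λ_ (yᘁ)).inv]
      apply (tensorRightHomEquiv Z y (yᘁ) (𝟙_ C)).symm.injective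
      rw [w.orth hZy hunit.1 ((tensorRightHomEquiv Z y (yᘁ) (𝟙_ C)).symm (f ≫ (λ_ (yᘁ)).inv))]
      exact (w.orth hZy hunit.1 _).symm
    have hW : w.LE (-1) (yᘁ ⊗ z) := by
      have := htensor_LE _ _ _ _ hdy hz
      rwa [show -(m - 1) + (m - 2) = -1 by ring] at this

    obtain ⟨v, hv⟩ := (tensorLeftHomEquiv z y (yᘁ) (𝟙_ C)).surjective (q ≫ (ρ_ y).inv)
    have hDv : Dom P (y ◁ v) := by
      have h1 := hDq.postcomp_iso hP (ρ_ y).symm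
      rw [Iso.symm_hom, ← hv] at h1
      change Dom P ((λ_ _).inv ≫ η_ _ _ ▷ _ ≫ (α_ _ _ _).hom ≫ _ ◁ v) at h1
      exact h1.of_comp.of_comp.of_comp
    have hDv' : Dom P (v ▷ y) := by
      have h1 := (hDv.precomp_iso (β_ (yᘁ ⊗ z) y)).postcomp_iso hP (β_ (𝟙_ C) y).symm
      rw [← BraidedCategory.braiding_naturality_left, Iso.symm_hom, Category.assoc,
        Iso.hom_inv_id, Category.comp_id] at h1
      exact h1
    obtain ⟨c', -, hc', -⟩ := hbounded (yᘁ ⊗ z)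
    obtain ⟨L, hL, hLneg, hLR⟩ := exists_family w x nwt hheart
      (fun a m hm => by
        obtain ⟨am, a', f, g, h, H, h1, h2, h3, -⟩ := hdecomp a m hm
        exact ⟨am, a', f, g, h, H, h1, h2, h3⟩) c' (-1 - c' + 1).toNat (-1) _ (by lia)
        (by lia) hW hc'
    obtain ⟨k, gg, hgg⟩ : ∃ (k : ℕ) (gg : Fin k → ι), Set.range gg = L := by
      have := hL.to_subtype
      obtain ⟨k, ⟨e⟩⟩ := Finite.exists_equiv_fin L
      refine ⟨k, fun j => (e.symm j : ι), ?_⟩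
      ext i
      exact ⟨by rintro ⟨j, rfl⟩; exact (e.symm j).2, fun hi => ⟨e ⟨i, hi⟩, by simp⟩⟩
    obtain ⟨n, -, hn⟩ := hnilp k gg (fun j => hLneg _ (hgg ▸ ⟨j, rfl⟩))
    have hzero := tensorFam_mem (fun j => x (gg j)) (yᘁ ⊗ z)
      (fun R hR hx => hLR R hR (by
        rw [← hgg]
        rintro _ ⟨j, rfl⟩
        exact hx j)) n _ (extClosed_hom (𝟙_ C)) hn
    obtain ⟨vn, hvn⟩ := hDv'.pow hP n
    rw [hzero vn, zero_whisker] at hvn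
    exact hP.isoClosed (λ_ y) (hvn.zero hP)
  refine ⟨fun a ha X P hP h => main a ha P hP (h a rfl) X, ?_⟩
  rintro P hP ⟨Y, hY⟩ - X
  refine ⟨fun hX => ?_, hP.zero X⟩
  by_contra hX0
  exact hY (main X hX0 P hP hX Y)
end

section
/- For every natural number M there exists n₀ ∈ ℕ such that for all n ≥ n₀ the following holds: there do not exist integers a_1, …, a_n and b_1, …, b_n with |a_i| ≤ M and b_i − 2a_i ≥ 1 for every i, together with a finite subset S ⊆ ℕ, such that Σ_{i=1}^n a_i = Σ_{j∈S} (2^j − 1) and Σ_{i=1}^n b_i = Σ_{j∈S} (2^{j+1} − 1). -/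
/-- For every natural number `M` there exists `n₀ ∈ ℕ` such that for all
`n ≥ n₀` there do not exist integers `a_1, …, a_n` and `b_1, …, b_n` with `|a_i| ≤ M` and
`b_i − 2 a_i ≥ 1` for every `i`, together with a finite subset `S ⊆ ℕ`, such that
`Σ a_i = Σ_{j ∈ S} (2^j − 1)` and `Σ b_i = Σ_{j ∈ S} (2^{j+1} − 1)`. -/
theorem stmt4 (M : ℕ) :
    ∃ n₀ : ℕ, ∀ n : ℕ, n₀ ≤ n →
      ¬ ∃ (a b : Fin n → ℤ) (S : Finset ℕ),
          (∀ i, |a i| ≤ (M : ℤ) ∧ 1 ≤ b i - 2 * a i) ∧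
          (∑ i, a i = ∑ j ∈ S, ((2 : ℤ) ^ j - 1)) ∧
          (∑ i, b i = ∑ j ∈ S, ((2 : ℤ) ^ (j + 1) - 1)) := by
  refine ⟨(M + 2) * (M + 1) + 1, ?_⟩
  rintro n hn ⟨a, b, S, h, ha, hb⟩
  have h1 : (n : ℤ) ≤ ∑ i, (b i - 2 * a i) := by
    have := Finset.sum_le_sum (s := Finset.univ) (fun i _ => (h i).2)
    simpa using this
  have h2 : ∑ i, (b i - 2 * a i) = (S.card : ℤ) := by
    rw [Finset.sum_sub_distrib, ← Finset.mul_sum, ha, hb, Finset.mul_sum,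
      ← Finset.sum_sub_distrib, Finset.card_eq_sum_ones, Nat.cast_sum]
    refine Finset.sum_congr rfl fun j _ => ?_
    push_cast
    ring
  have h3 : ∑ i, a i ≤ (n : ℤ) * M := by
    have := Finset.sum_le_sum (s := Finset.univ) (fun i _ => (abs_le.mp (h i).1).2)
    simpa using this
  have h4 : ∑ j ∈ S, (if j < M + 2 then -((M : ℤ) + 1) else 0) ≤
      ∑ j ∈ S, (((2 : ℤ) ^ j - 1) - ((M : ℤ) + 1)) := by
    refine Finset.sum_le_sum fun j _ => ?_
    have hj : (j : ℤ) + 1 ≤ 2 ^ j := by exact_mod_cast Nat.lt_two_pow_self (n := j)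
    split_ifs <;> omega
  have h5 : (S.filter (fun j => j < M + 2)).card ≤ M + 2 := by
    have : S.filter (fun j => j < M + 2) ⊆ Finset.range (M + 2) := by
      intro j hj
      simpa using (Finset.mem_filter.mp hj).2
    simpa using Finset.card_le_card this
  rw [← Finset.sum_filter, Finset.sum_const, Finset.sum_sub_distrib, Finset.sum_const,
    ← ha, nsmul_eq_mul, nsmul_eq_mul] at h4
  have h5' : ((S.filter (fun j => j < M + 2)).card : ℤ) ≤ M + 2 := by exact_mod_cast h5
  have hn' : ((M : ℤ) + 2) * (M + 1) + 1 ≤ n := by exact_mod_cast hn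
  have hM : (0 : ℤ) ≤ M := by positivity
  have h6 := mul_le_mul_of_nonneg_right h5' (by linarith : (0 : ℤ) ≤ (M : ℤ) + 1)
  have h7 := mul_le_mul_of_nonneg_right (h1.trans_eq h2) hM
  linarith
end

section
/- Let K be a triangulated category equipped with a bounded weight structure, and let (x_n)_{n∈ℕ} be a sequence of objects of the heart K^♥, each not isomorphic to 0, such that for every object a ∈ K^♥ there are only finitely many n for which Hom(a[l], x_n) ≠ 0 for some l ∈ ℤ. Then for every object a ∈ K there exists n such that Hom(a[l], x_n) = 0 for all l ∈ ℤ. Consequently, K is not classically finitely generated: for every object a of K, the smallest thick (closed under direct summands) triangulated subcategory of K containing a is a proper subcategory. -/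
open CategoryTheory CategoryTheory.Limits CategoryTheory.Pretriangulated

universe v u

variable (C : Type u) [Category.{v} C] [HasZeroObject C] [Preadditive C] [HasShift C ℤ]
  [∀ n : ℤ, (shiftFunctor C n).Additive] [Pretriangulated C]

/-- A thick triangulated subcategory of a triangulated category, rendered as a predicate on
objects containing the zero objects, closed under shifts, cones and direct summands. -/
structure IsThickTriangulatedSubcategory (P : C → Prop) : Prop where
  zero : ∀ X : C, IsZero X → P X
  isoClosed : ∀ {X Y : C}, (X ≅ Y) → P X → P Y
  shift : ∀ (X : C) (n : ℤ), P X → P (X⟦n⟧)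
  ext : ∀ T ∈ distTriang C, P T.obj₁ → P T.obj₂ → P T.obj₃
  summand : ∀ {X Y : C}, P Y → ∀ (i : X ⟶ Y) (r : Y ⟶ X), i ≫ r = 𝟙 X → P X

section Helpers

variable {C}

/-- Vanishing of Hom descends along a shift. -/
lemma hom_zero_of_shift {A B A' B' : C} (m : ℤ) (eA : A' ≅ A⟦m⟧) (eB : B⟦m⟧ ≅ B')
    (h : ∀ f : A' ⟶ B', f = 0) (f : A ⟶ B) : f = 0 := by
  have h1 := h (eA.hom ≫ f⟦m⟧' ≫ eB.hom)
  have h2 : f⟦m⟧' = 0 := by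
    rw [← cancel_epi eA.hom, ← cancel_mono eB.hom]
    simpa using h1
  apply (shiftFunctor C m).map_injective
  simpa using h2

/-- Every map from every shift of `X` to `y` vanishes. -/
def LeftOrth (y X : C) : Prop := ∀ (l : ℤ) (f : X ⟶ y⟦l⟧), f = 0

lemma leftOrth_iff (y X : C) : LeftOrth y X ↔ ∀ (l : ℤ) (f : X⟦l⟧ ⟶ y), f = 0 := by
  constructor
  · intro h l f
    exact hom_zero_of_shift (-l) ((shiftFunctorCompIsoId C l (-l) (by simp)).app X).symm
      (Iso.refl _) (h (-l)) f
  · intro h l f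
    exact hom_zero_of_shift (-l) (Iso.refl _)
      ((shiftFunctorCompIsoId C l (-l) (by simp)).app y) (h (-l)) f

lemma leftOrth_iso {y X X' : C} (e : X ≅ X') (h : LeftOrth y X) : LeftOrth y X' := by
  intro l f
  have := h l (e.hom ≫ f)
  rwa [← cancel_epi e.hom, comp_zero]

lemma leftOrth_shift {y X : C} (m : ℤ) (h : LeftOrth y X) : LeftOrth y (X⟦m⟧) := by
  intro l f
  exact hom_zero_of_shift (-m) ((shiftFunctorCompIsoId C m (-m) (by simp)).app X).symm
    ((shiftFunctorAdd' C l (-m) (l + -m) rfl).app y).symm (h (l + -m)) f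

lemma leftOrth_unshift {y X : C} (m : ℤ) (h : LeftOrth y (X⟦m⟧)) : LeftOrth y X :=
  leftOrth_iso ((shiftFunctorCompIsoId C m (-m) (by simp)).app X) (leftOrth_shift (-m) h)

lemma leftOrth_ext₂ {y : C} (T : Triangle C) (hT : T ∈ distTriang C)
    (h1 : LeftOrth y T.obj₁) (h3 : LeftOrth y T.obj₃) : LeftOrth y T.obj₂ := by
  intro l f
  obtain ⟨g, hg⟩ := Triangle.yoneda_exact₂ T hT f (h1 l _)
  rw [hg, h3 l g, comp_zero]

lemma leftOrth_ext₃ {y : C} (T : Triangle C) (hT : T ∈ distTriang C)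
    (h1 : LeftOrth y T.obj₁) (h2 : LeftOrth y T.obj₂) : LeftOrth y T.obj₃ := by
  intro l f
  obtain ⟨g, hg⟩ := Triangle.yoneda_exact₃ T hT f (h2 l _)
  rw [hg, leftOrth_shift 1 h1 l g, comp_zero]

lemma leftOrth_thick (y : C) : IsThickTriangulatedSubcategory C (LeftOrth y) where
  zero X hX l f := hX.eq_of_src f 0
  isoClosed e h := leftOrth_iso e h
  shift X n h := leftOrth_shift n h
  ext T hT h1 h2 := leftOrth_ext₃ T hT h1 h2
  summand := by
    intro X Y h i r hir l f
    have := h l (r ≫ f)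
    rw [← Category.id_comp f, ← hir, Category.assoc, this, comp_zero]

variable (w : WeightStructure C)

lemma ws_orth (n : ℤ) {X Y : C} (hX : w.GE (n + 1) X) (hY : w.LE n Y) (f : X ⟶ Y) : f = 0 := by
  refine hom_zero_of_shift n (Iso.refl _) (Iso.refl _) (w.orth ?_ ?_) f
  · simpa using w.shift_GE (n + 1) n X hX
  · simpa using w.shift_LE n n Y hY

lemma ws_GE_one {Z : C} (h : ∀ Y : C, w.LE 0 Y → ∀ f : Z ⟶ Y, f = 0) : w.GE 1 Z := by
  obtain ⟨A, B, f, g, k, hT, hA, hB⟩ := w.decomp Z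
  obtain ⟨s, hs⟩ := Triangle.coyoneda_exact₂ _ hT (𝟙 Z) (h B hB _)
  exact w.summand_GE 1 hA s f hs.symm

lemma ws_LE_zero {Z : C} (h : ∀ Y : C, w.GE 1 Y → ∀ f : Y ⟶ Z, f = 0) : w.LE 0 Z := by
  obtain ⟨A, B, f, g, k, hT, hA, hB⟩ := w.decomp Z
  obtain ⟨s, hs⟩ := Triangle.yoneda_exact₂ _ hT (𝟙 Z) (h A hA _)
  exact w.summand_LE 0 hB g s hs.symm

lemma ws_GE (n : ℤ) {Z : C} (h : ∀ Y : C, w.LE n Y → ∀ f : Z ⟶ Y, f = 0) :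
    w.GE (n + 1) Z := by
  have h1 : w.GE 1 (Z⟦n⟧) := by
    apply ws_GE_one
    intro Y hY f
    refine hom_zero_of_shift (-n) ((shiftFunctorCompIsoId C n (-n) (by simp)).app Z).symm
      (Iso.refl _) (h _ ?_) f
    simpa using w.shift_LE 0 (-n) Y hY
  have h2 := w.shift_GE 1 (-n) _ h1
  rw [show (1 : ℤ) - -n = n + 1 by ring] at h2
  exact w.isoClosed_GE _ ((shiftFunctorCompIsoId C n (-n) (by simp)).app Z) h2

lemma ws_LE (n : ℤ) {Z : C} (h : ∀ Y : C, w.GE (n + 1) Y → ∀ f : Y ⟶ Z, f = 0) :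
    w.LE n Z := by
  have h1 : w.LE 0 (Z⟦n⟧) := by
    apply ws_LE_zero
    intro Y hY f
    refine hom_zero_of_shift (-n) (Iso.refl _)
      ((shiftFunctorCompIsoId C n (-n) (by simp)).app Z) (h _ ?_) f
    have := w.shift_GE 1 (-n) Y hY
    rwa [show (1 : ℤ) - -n = n + 1 by ring] at this
  have h2 := w.shift_LE 0 (-n) _ h1
  rw [show (0 : ℤ) - -n = n by ring] at h2
  exact w.isoClosed_LE _ ((shiftFunctorCompIsoId C n (-n) (by simp)).app Z) h2

lemma ws_GE_ext (n : ℤ) (T : Triangle C) (hT : T ∈ distTriang C)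
    (h1 : w.GE (n + 1) T.obj₁) (h3 : w.GE (n + 1) T.obj₃) : w.GE (n + 1) T.obj₂ := by
  apply ws_GE
  intro Y hY f
  obtain ⟨g, hg⟩ := Triangle.yoneda_exact₂ T hT f (ws_orth w n h1 hY _)
  rw [hg, ws_orth w n h3 hY g, comp_zero]

lemma ws_LE_ext (n : ℤ) (T : Triangle C) (hT : T ∈ distTriang C)
    (h1 : w.LE n T.obj₁) (h3 : w.LE n T.obj₃) : w.LE n T.obj₂ := by
  apply ws_LE
  intro Y hY f
  obtain ⟨g, hg⟩ := Triangle.coyoneda_exact₂ T hT f (ws_orth w n hY h3 _)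
  rw [hg, ws_orth w n hY h1 g, zero_comp]

lemma ws_LE_add (n : ℤ) (k : ℕ) {X : C} (h : w.LE n X) : w.LE (n + k) X := by
  induction k with
  | zero => simpa using h
  | succ k ih =>
    have := w.mono_LE _ _ ih
    rwa [show n + ((k + 1 : ℕ) : ℤ) = n + k + 1 by push_cast; ring]

lemma finite_bad (x : ℕ → C)
    (hfin : ∀ a : C, w.LE 0 a → w.GE 0 a → {n : ℕ | ¬ LeftOrth (x n) a}.Finite) (k : ℕ) :
    ∀ X : C, w.GE 0 X → w.LE k X → {n : ℕ | ¬ LeftOrth (x n) X}.Finite := by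
  induction k with
  | zero => intro X h0 h1; exact hfin X (by simpa using h1) h0
  | succ k ih =>
    intro X h0 h1
    obtain ⟨A, B, f, g, h, hT, hA, hB⟩ := w.decomp X
    have hA1 : w.GE 0 (A⟦(1 : ℤ)⟧) := by simpa using w.shift_GE 1 1 A hA
    have hB0 : w.GE 0 B := by
      have := ws_GE_ext w (-1) _ (rot_of_distTriang _ hT) (by simpa using h0) (by simpa using hA1)
      simpa using this
    have hB1 : w.LE ((k + 1 : ℕ) : ℤ) (B⟦(-1 : ℤ)⟧) := by
      have := ws_LE_add w _ k (w.shift_LE 0 (-1) B hB)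
      rwa [show (0 : ℤ) - -1 + k = ((k + 1 : ℕ) : ℤ) by push_cast; ring] at this
    have hAk : w.LE ((k + 1 : ℕ) : ℤ) A :=
      ws_LE_ext w _ _ (inv_rot_of_distTriang _ hT) hB1 h1
    have hAk1 : w.LE (k : ℤ) (A⟦(1 : ℤ)⟧) := by
      have := w.shift_LE _ 1 A hAk
      rwa [show ((k + 1 : ℕ) : ℤ) - 1 = k by push_cast; ring] at this
    refine ((ih _ hA1 hAk1).union (hfin B hB hB0)).subset ?_
    intro n hn
    by_contra hc
    simp only [Set.mem_union, Set.mem_ofPred_eq, not_or, not_not] at hc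
    exact hn (leftOrth_ext₂ _ hT (leftOrth_unshift 1 hc.1) hc.2)

end Helpers

/-- Let `C` be a triangulated category equipped with a bounded weight
structure, and let `(x_n)` be a sequence of objects of the heart, each nonzero, such that
for every object `a` of the heart there are only finitely many `n` for which
`Hom(a[l], x_n) ≠ 0` for some `l ∈ ℤ`. Then for every object `a` of `C` there exists `n`
with `Hom(a[l], x_n) = 0` for all `l ∈ ℤ`; consequently `C` is not classically finitely
generated: for every object `a`, the smallest thick triangulated subcategory containing `a`
is proper (there is an object lying outside some thick triangulated subcategory
containing `a`). -/
theorem stmt7 (w : WeightStructure C)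
    (hbounded : ∀ X : C, ∃ a b : ℤ, w.GE a X ∧ w.LE b X)
    (x : ℕ → C)
    (hheart : ∀ n, w.LE 0 (x n) ∧ w.GE 0 (x n))
    (hnonzero : ∀ n, ¬ IsZero (x n))
    (hfin : ∀ a : C, w.LE 0 a → w.GE 0 a →
      {n : ℕ | ∃ (l : ℤ) (f : a⟦l⟧ ⟶ x n), f ≠ 0}.Finite) :
    (∀ a : C, ∃ n : ℕ, ∀ (l : ℤ) (f : a⟦l⟧ ⟶ x n), f = 0) ∧
    (∀ a : C, ∃ (y : C) (P : C → Prop),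
      IsThickTriangulatedSubcategory C P ∧ P a ∧ ¬ P y) := by
  have hfin' : ∀ a : C, w.LE 0 a → w.GE 0 a → {n : ℕ | ¬ LeftOrth (x n) a}.Finite := by
    intro a h1 h2
    refine (hfin a h1 h2).subset ?_
    intro n hn
    rw [Set.mem_ofPred_eq, leftOrth_iff] at hn
    push Not at hn
    exact hn
  have key : ∀ a : C, ∃ n : ℕ, LeftOrth (x n) a := by
    intro X
    obtain ⟨a, b, ha, hb⟩ := hbounded X
    have hX : {n : ℕ | ¬ LeftOrth (x n) (X⟦a⟧)}.Finite := by
      apply finite_bad w x hfin' (b - a).toNat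
      · simpa using w.shift_GE a a X ha
      · have h := ws_LE_add w _ (a - b).toNat (w.shift_LE b a X hb)
        rwa [show b - a + ((a - b).toNat : ℤ) = ((b - a).toNat : ℤ) by omega] at h
    obtain ⟨n, hn⟩ := hX.exists_notMem
    exact ⟨n, leftOrth_unshift a (not_not.mp hn)⟩
  refine ⟨fun a => ?_, fun a => ?_⟩
  · obtain ⟨n, hn⟩ := key a
    exact ⟨n, (leftOrth_iff _ _).mp hn⟩
  · obtain ⟨n, hn⟩ := key a
    refine ⟨x n, LeftOrth (x n), leftOrth_thick _, hn, fun h => hnonzero n ?_⟩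
    have h0 := h 0 ((shiftFunctorZero C ℤ).app (x n)).inv
    rw [IsZero.iff_id_eq_zero]
    have h1 := ((shiftFunctorZero C ℤ).app (x n)).inv_hom_id
    rw [h0, zero_comp] at h1
    exact h1.symm
end

section
/- Let C be a monoidal preadditive category with binary biproducts whose tensor product is additive in each variable, in which every morphism decomposes as an isomorphism plus zero, and which has no ⊗-zero divisors, meaning that x ⊗ w ≅ 0 implies x ≅ 0 or w ≅ 0. Then for every object x not isomorphic to 0, tensoring with x is faithful: if f : y → z is a morphism with id_x ⊗ f = 0, then f = 0. -/
open CategoryTheory CategoryTheory.Limits CategoryTheory.MonoidalCategory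

universe v u

/-- A morphism `f : X ⟶ Y` in an additive category with binary biproducts decomposes as an
isomorphism plus zero if there exist objects `I, K, L` and isomorphisms `u : X ≅ I ⊞ K` and
`v : I ⊞ L ≅ Y` such that `f = v ∘ (id_I ⊞ 0) ∘ u`. -/
def DecomposesAsIsoPlusZero {C : Type u} [Category.{v} C] [Preadditive C]
    [HasBinaryBiproducts C] {X Y : C} (f : X ⟶ Y) : Prop :=
  ∃ (I K L : C) (u : X ≅ I ⊞ K) (v : I ⊞ L ≅ Y),
    f = u.hom ≫ biprod.map (𝟙 I) (0 : K ⟶ L) ≫ v.hom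

/-- Let `C` be a monoidal preadditive category with binary biproducts whose
tensor product is additive in each variable, in which every morphism decomposes as an
isomorphism plus zero, and which has no `⊗`-zero divisors. Then for every object `x` not
isomorphic to `0`, tensoring with `x` is faithful: if `f : y ⟶ z` satisfies
`id_x ⊗ f = 0`, then `f = 0`. -/
theorem stmt12 {C : Type u} [Category.{v} C] [Preadditive C] [MonoidalCategory C]
    [MonoidalPreadditive C] [HasBinaryBiproducts C]
    (hdecomp : ∀ {X Y : C} (f : X ⟶ Y), DecomposesAsIsoPlusZero f)
    (hnozero : ∀ x w : C, IsZero (x ⊗ w) → IsZero x ∨ IsZero w) :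
    ∀ x : C, ¬ IsZero x → ∀ {y z : C} (f : y ⟶ z), x ◁ f = 0 → f = 0 := by
  intro x hx y z f hf
  obtain ⟨I, K, L, u, v, h⟩ := hdecomp f
  have e : 𝟙 I = (biprod.inl ≫ u.inv) ≫ f ≫ (v.inv ≫ biprod.fst) := by
    rw [h]; simp
  have hI : IsZero (x ⊗ I) := by
    rw [IsZero.iff_id_eq_zero, ← MonoidalCategory.whiskerLeft_id, e,
      MonoidalCategory.whiskerLeft_comp, MonoidalCategory.whiskerLeft_comp x f, hf]
    simp
  have hI' : IsZero I := (hnozero x I hI).resolve_left hx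
  have h0 : 𝟙 I = 0 := (IsZero.iff_id_eq_zero I).1 hI'
  rw [h, h0]
  have : biprod.map (0 : I ⟶ I) (0 : K ⟶ L) = 0 := by
    ext <;> simp
  rw [this]; simp
end

section
/- Let C be an abelian monoidal category whose tensor product is additive in each variable, in which every monomorphism splits, and whose monoidal unit 𝟙 is a simple object. Let X be an object of C admitting a right dual X^∨ (with coevaluation η : 𝟙 → X ⊗ X^∨ and evaluation ε : X^∨ ⊗ X → 𝟙 satisfying the triangle identities), and suppose X is not isomorphic to 0. Then the coevaluation η : 𝟙 → X ⊗ X^∨ is a split monomorphism; in particular 𝟙 is a direct summand (retract) of X ⊗ X^∨. -/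
open CategoryTheory CategoryTheory.Limits CategoryTheory.MonoidalCategory

universe v u

/-- Let `C` be an abelian monoidal category whose tensor product is additive
in each variable, in which every monomorphism splits, and whose monoidal unit `𝟙` is a
simple object. Let `X` be an object of `C` admitting a right dual `Xᵛ` (with coevaluation
`η : 𝟙 ⟶ X ⊗ Xᵛ` and evaluation `ε : Xᵛ ⊗ X ⟶ 𝟙` satisfying the triangle identities,
i.e. an exact pairing), and suppose `X` is not isomorphic to `0`. Then the coevaluation
`η : 𝟙 ⟶ X ⊗ Xᵛ` is a split monomorphism; in particular `𝟙` is a retract of `X ⊗ Xᵛ`. -/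
theorem stmt13 {C : Type u} [Category.{v} C] [Abelian C] [MonoidalCategory C]
    [MonoidalPreadditive C] [Simple (𝟙_ C)]
    (hsplitmono : ∀ {A B : C} (f : A ⟶ B), Mono f → ∃ r : B ⟶ A, f ≫ r = 𝟙 A)
    (X Xv : C) [ExactPairing X Xv] (hX : ¬ IsZero X) :
    ∃ r : X ⊗ Xv ⟶ 𝟙_ C, η_ X Xv ≫ r = 𝟙 (𝟙_ C) := by
  have hne : η_ X Xv ≠ 0 := by
    intro h
    apply hX
    have h1 := ExactPairing.evaluation_coevaluation X Xv
    rw [h, MonoidalPreadditive.zero_whiskerRight, zero_comp] at h1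
    rw [IsZero.iff_id_eq_zero]
    calc 𝟙 X = (λ_ X).inv ≫ ((λ_ X).hom ≫ (ρ_ X).inv) ≫ (ρ_ X).hom := by simp
      _ = 0 := by rw [← h1]; simp
  have hm : Mono (η_ X Xv) :=
    Preadditive.mono_of_kernel_zero (kernel_zero_of_nonzero_from_simple hne)
  exact hsplitmono _ hm
end

section
/- Let C be an abelian symmetric monoidal category whose tensor product is additive in each variable, in which every monomorphism splits and whose monoidal unit 𝟙 is a simple object. If x and y are objects of C, each admitting a right dual and each not isomorphic to 0, then x ⊗ y is not isomorphic to 0. -/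
open CategoryTheory CategoryTheory.Limits CategoryTheory.MonoidalCategory

universe v u

/-- Let `C` be an abelian symmetric monoidal category whose tensor product is
additive in each variable, in which every monomorphism splits and whose monoidal unit `𝟙`
is a simple object. If `x` and `y` are objects of `C`, each admitting a right dual (i.e.
each part of an exact pairing) and each not isomorphic to `0`, then `x ⊗ y` is not
isomorphic to `0`. -/
theorem stmt14 {C : Type u} [Category.{v} C] [Abelian C] [MonoidalCategory C]
    [SymmetricCategory C] [MonoidalPreadditive C] [Simple (𝟙_ C)]
    (hsplitmono : ∀ {A B : C} (f : A ⟶ B), Mono f → ∃ r : B ⟶ A, f ≫ r = 𝟙 A)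
    (x y xv yv : C) [ExactPairing x xv] [ExactPairing y yv]
    (hx : ¬ IsZero x) (hy : ¬ IsZero y) :
    ¬ IsZero (x ⊗ y) := by
  intro hz
  have hη : η_ x xv ≠ 0 := by
    intro h0
    apply hx
    have h := ExactPairing.evaluation_coevaluation x xv
    rw [h0, MonoidalPreadditive.zero_whiskerRight, zero_comp] at h
    rw [IsZero.iff_id_eq_zero]
    calc 𝟙 x = (λ_ x).inv ≫ ((λ_ x).hom ≫ (ρ_ x).inv) ≫ (ρ_ x).hom := by simp
      _ = 0 := by rw [← h]; simp
  have hm : Mono (η_ x xv) := mono_of_nonzero_from_simple hη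
  obtain ⟨r, hr⟩ := hsplitmono _ hm
  have hz1 : IsZero ((x ⊗ y) ⊗ xv) := by
    rw [IsZero.iff_id_eq_zero] at hz ⊢
    rw [← id_whiskerRight, hz, MonoidalPreadditive.zero_whiskerRight]
  have hz2 : IsZero ((x ⊗ xv) ⊗ y) :=
    hz1.of_iso (α_ x xv y ≪≫ whiskerLeftIso x (β_ xv y) ≪≫ (α_ x y xv).symm)
  apply hy
  rw [IsZero.iff_id_eq_zero]
  calc 𝟙 y = (λ_ y).inv ≫ ((η_ x xv ≫ r) ▷ y) ≫ (λ_ y).hom := by rw [hr]; simp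
    _ = (λ_ y).inv ≫ (η_ x xv ▷ y ≫ r ▷ y) ≫ (λ_ y).hom := by rw [comp_whiskerRight]
    _ = 0 := by rw [hz2.eq_of_tgt (η_ x xv ▷ y) 0]; simp
end

section
/- Let 𝒜 be an abelian category in which every short exact sequence splits. Then every cochain complex X over 𝒜 is homotopy equivalent to a complex with zero differentials; explicitly, X is homotopy equivalent to the complex whose n-th term is the cohomology H^n(X) and all of whose differentials are zero. -/
open CategoryTheory CategoryTheory.Limits

universe v u

lemma aux_homotopy {𝒜 : Type u} [Category.{v} 𝒜] [Abelian 𝒜] (K : CochainComplex 𝒜 ℤ)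
    (r : ∀ n, K.X n ⟶ K.cycles n) (hr : ∀ n, K.iCycles n ≫ r n = 𝟙 _)
    (s : ∀ n, K.homology n ⟶ K.cycles n) (hs : ∀ n, s n ≫ K.homologyπ n = 𝟙 _)
    (i j : ℤ) (hij : (ComplexShape.up ℤ).Rel i j) :
    ∃ h : K.cycles j ⟶ K.X i, h ≫ K.toCycles i j = 𝟙 _ - K.homologyπ j ≫ s j ∧
      K.toCycles i j ≫ h = 𝟙 _ - r i ≫ K.iCycles i := by
  have hex : (ShortComplex.mk (K.toCycles i j) (K.homologyπ j)
      (K.toCycles_comp_homologyπ i j)).Exact :=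
    ShortComplex.exact_of_g_is_cokernel _
      (K.homologyIsCokernel i j ((ComplexShape.up ℤ).prev_eq' hij))
  let q : K.X i ⟶ kernel (K.homologyπ j) :=
    kernel.lift (K.homologyπ j) (K.toCycles i j) (K.toCycles_comp_homologyπ i j)
  have hq : Epi q := hex.epi_kernelLift
  have hqm : q ≫ kernel.ι (K.homologyπ j) = K.toCycles i j := kernel.lift_ι _ _ _
  have hiq : K.iCycles i ≫ q = 0 := by
    rw [← cancel_mono (kernel.ι _), ← cancel_mono (K.iCycles j)]
    simp [hqm]
  obtain ⟨t, ht⟩ : ∃ t, q ≫ t = 𝟙 _ - r i ≫ K.iCycles i := by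
    have hk : kernel.ι q ≫ (𝟙 _ - r i ≫ K.iCycles i) = 0 := by
      have hd : kernel.ι q ≫ K.d i j = 0 := by
        rw [← K.toCycles_i i j, ← hqm]
        simp
      obtain ⟨x, hx⟩ : ∃ x, x ≫ K.iCycles i = kernel.ι q :=
        ⟨K.liftCycles (kernel.ι q) j ((ComplexShape.up ℤ).next_eq' hij) hd,
          K.liftCycles_i _ _ _ _⟩
      rw [← hx]
      simp [Preadditive.comp_sub, reassoc_of% (hr i)]
    exact ⟨Abelian.epiDesc q _ hk, Abelian.comp_epiDesc q _ hk⟩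
  have htq : t ≫ q = 𝟙 _ := by
    rw [← cancel_epi q, reassoc_of% ht]
    simp [Preadditive.sub_comp, hiq]
  obtain ⟨l, hl⟩ : ∃ l, l ≫ kernel.ι (K.homologyπ j) = 𝟙 _ - K.homologyπ j ≫ s j :=
    ⟨kernel.lift _ (𝟙 _ - K.homologyπ j ≫ s j) (by simp [Preadditive.sub_comp, hs]),
      kernel.lift_ι _ _ _⟩
  have hel : K.toCycles i j ≫ l = q := by
    rw [← cancel_mono (kernel.ι _), Category.assoc, hl, hqm]
    simp [Preadditive.comp_sub]
  refine ⟨l ≫ t, ?_, ?_⟩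
  · rw [← hqm, Category.assoc, reassoc_of% htq, hl]
  · rw [reassoc_of% hel, ht]

/-- Let `𝒜` be an abelian category in which every short exact sequence splits.
Then every cochain complex `K` over `𝒜` is homotopy equivalent to a complex with zero
differentials; explicitly, `K` is homotopy equivalent to the complex whose `n`-th term is
the cohomology `H^n(K)` and all of whose differentials are zero. -/
theorem stmt15 {𝒜 : Type u} [Category.{v} 𝒜] [Abelian 𝒜]
    (hsplit : ∀ S : ShortComplex 𝒜, S.ShortExact → Nonempty S.Splitting) :
    ∀ K : CochainComplex 𝒜 ℤ,
      Nonempty (HomotopyEquiv K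
        { X := fun n => K.homology n
          d := fun _ _ => (0 : K.homology _ ⟶ K.homology _)
          shape := fun _ _ _ => rfl
          d_comp_d' := fun _ _ _ _ _ => Limits.zero_comp }) := by
  intro K
  have hr : ∀ n, ∃ r : K.X n ⟶ K.cycles n, K.iCycles n ≫ r = 𝟙 _ := fun n => by
    obtain ⟨σ⟩ := hsplit (ShortComplex.mk (K.iCycles n) (cokernel.π (K.iCycles n)) (by simp))
      { exact := ShortComplex.exact_of_g_is_cokernel _ (cokernelIsCokernel _)
        mono_f := by dsimp; infer_instance
        epi_g := by dsimp; infer_instance }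
    exact ⟨σ.r, σ.f_r⟩
  have hs : ∀ n, ∃ s : K.homology n ⟶ K.cycles n, s ≫ K.homologyπ n = 𝟙 _ := fun n => by
    obtain ⟨σ⟩ := hsplit (ShortComplex.mk (kernel.ι (K.homologyπ n)) (K.homologyπ n) (by simp))
      { exact := ShortComplex.exact_of_f_is_kernel _ (kernelIsKernel _)
        mono_f := by dsimp; infer_instance
        epi_g := by dsimp; infer_instance }
    exact ⟨σ.s, σ.s_g⟩
  choose r hr using hr
  choose s hs using hs
  choose h h₁ h₂ using aux_homotopy K r hr s hs
  have hdp : ∀ i j, K.d i j ≫ r j ≫ K.homologyπ j = 0 := fun i j => by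
    rw [← K.toCycles_i i j, Category.assoc, reassoc_of% (hr j), K.toCycles_comp_homologyπ]
  refine ⟨{ hom := { f := fun n => r n ≫ K.homologyπ n, comm' := ?_ }
            inv := { f := fun n => s n ≫ K.iCycles n, comm' := ?_ }
            homotopyHomInvId := Homotopy.symm
              { hom := fun i j => if w : (ComplexShape.up ℤ).Rel j i then r i ≫ h j i w else 0
                zero := fun i j w => dif_neg w
                comm := ?_ }
            homotopyInvHomId := Homotopy.ofEq ?_ }⟩
  · intro i j _
    simp [hdp]
  · intro i j _
    simp
  · intro n
    have w₁ : (ComplexShape.up ℤ).Rel n (n + 1) := rfl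
    have w₂ : (ComplexShape.up ℤ).Rel (n - 1) n := by simp
    rw [dNext_eq _ w₁, prevD_eq _ w₂, dif_pos w₁, dif_pos w₂, ← K.toCycles_i n (n + 1),
      ← K.toCycles_i (n - 1) n]
    simp only [Category.assoc, reassoc_of% (hr (n + 1)), h₂, reassoc_of% (h₁ (n - 1) n w₂)]
    simp [Preadditive.sub_comp, Preadditive.comp_sub]
  · ext n
    simp [reassoc_of% (hr n), hs n]
end

section
/- Let 𝒜 be an abelian category in which every short exact sequence splits. Then every quasi-isomorphism of cochain complexes over 𝒜 is a homotopy equivalence. In particular, a cochain complex over 𝒜 is homotopy equivalent to the zero complex if and only if all of its cohomology objects vanish. -/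
open CategoryTheory CategoryTheory.Limits ZeroObject

universe v u

lemma exists_vonNeumann {𝒜 : Type u} [Category.{v} 𝒜] [Abelian 𝒜]
    (hsplit : ∀ S : ShortComplex 𝒜, S.ShortExact → Nonempty S.Splitting)
    {X Y : 𝒜} (f : X ⟶ Y) : ∃ s : Y ⟶ X, f ≫ s ≫ f = f := by
  obtain ⟨a⟩ := hsplit (ShortComplex.mk (kernel.ι (factorThruImage f)) (factorThruImage f)
    (by simp)) { exact := ShortComplex.exact_kernel _ }
  obtain ⟨b⟩ := hsplit (ShortComplex.mk (image.ι f) (cokernel.π (image.ι f)) (by simp))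
    { exact := ShortComplex.exact_cokernel _ }
  refine ⟨b.r ≫ a.s, ?_⟩
  have ha : a.s ≫ factorThruImage f = 𝟙 _ := a.s_g
  have hb : image.ι f ≫ b.r = 𝟙 _ := b.f_r
  calc f ≫ (b.r ≫ a.s) ≫ f
      = (factorThruImage f ≫ image.ι f) ≫ (b.r ≫ a.s) ≫ (factorThruImage f ≫ image.ι f) := by
        rw [image.fac]
    _ = factorThruImage f ≫ (image.ι f ≫ b.r) ≫ (a.s ≫ factorThruImage f) ≫ image.ι f := by
        simp only [Category.assoc]
    _ = f := by rw [ha, hb, Category.id_comp, Category.id_comp, image.fac]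

lemma contractible_of_acyclic {𝒜 : Type u} [Category.{v} 𝒜] [Abelian 𝒜]
    (hsplit : ∀ S : ShortComplex 𝒜, S.ShortExact → Nonempty S.Splitting)
    (K : CochainComplex 𝒜 ℤ) (hK : K.Acyclic) : Nonempty (Homotopy (𝟙 K) 0) := by
  choose s hs using fun i j : ℤ => exists_vonNeumann hsplit (K.d i j)
  have key (i : ℤ) : (𝟙 (K.X i) - K.d i (i+1) ≫ s i (i+1)) ≫ s (i-1) i ≫ K.d (i-1) i
      = 𝟙 (K.X i) - K.d i (i+1) ≫ s i (i+1) := by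
    have hex : (K.sc' (i-1) i (i+1)).Exact :=
      (K.exactAt_iff' (i-1) i (i+1) (by simp) (by simp)).1 (hK i)
    have h0 : (𝟙 (K.X i) - K.d i (i+1) ≫ s i (i+1)) ≫ K.d i (i+1) = 0 := by
      rw [Preadditive.sub_comp, Category.assoc, hs, Category.id_comp, sub_self]
    obtain ⟨A, π, _, x, hx⟩ := hex.exact_up_to_refinements
      (𝟙 (K.X i) - K.d i (i+1) ≫ s i (i+1)) h0
    change A ⟶ K.X (i-1) at x
    change π ≫ (𝟙 (K.X i) - K.d i (i+1) ≫ s i (i+1)) = x ≫ K.d (i-1) i at hx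
    rw [← cancel_epi π, ← Category.assoc, hx, Category.assoc, hs]
  refine ⟨{
    hom := fun i j => if j + 1 = i then
      (𝟙 (K.X i) - K.d i (i+1) ≫ s i (i+1)) ≫ s j i else 0
    zero := fun i j h => if_neg h
    comm := fun i => ?_ }⟩
  rw [dNext_eq _ (show (ComplexShape.up ℤ).Rel i (i+1) by simp),
    prevD_eq _ (show (ComplexShape.up ℤ).Rel (i-1) i by simp)]
  simp only [if_true, sub_add_cancel, Category.assoc, key]
  simp [Preadditive.sub_comp, Preadditive.comp_sub]

/-- Let `𝒜` be an abelian category in which every short exact sequence splits.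
Then every quasi-isomorphism of cochain complexes over `𝒜` is a homotopy equivalence.
In particular, a cochain complex over `𝒜` is homotopy equivalent to the zero complex if and
only if all of its cohomology objects vanish. -/
theorem stmt16 {𝒜 : Type u} [Category.{v} 𝒜] [Abelian 𝒜]
    (hsplit : ∀ S : ShortComplex 𝒜, S.ShortExact → Nonempty S.Splitting) :
    (∀ {K L : CochainComplex 𝒜 ℤ} (f : K ⟶ L), QuasiIso f →
      ∃ e : HomotopyEquiv K L, e.hom = f) ∧
    (∀ K : CochainComplex 𝒜 ℤ,
      Nonempty (HomotopyEquiv K (0 : CochainComplex 𝒜 ℤ)) ↔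
        ∀ n : ℤ, IsZero (K.homology n)) := by
  constructor
  · intro K L f hf
    have hP (M : CochainComplex 𝒜 ℤ) : M.IsKProjective := ⟨fun {N} g hN => by
      obtain ⟨h⟩ := contractible_of_acyclic hsplit N hN
      exact ⟨(Homotopy.ofEq (by simp)).trans ((h.compLeft g).trans (Homotopy.ofEq (by simp)))⟩⟩
    have := hP K
    have := hP L
    exact (CochainComplex.IsKProjective.quasiIso_iff f).1 hf
  · intro K
    constructor
    · rintro ⟨e⟩ n
      have h0 : IsZero ((0 : CochainComplex 𝒜 ℤ).homology n) :=
        (HomologicalComplex.homologyFunctor 𝒜 (ComplexShape.up ℤ) n).map_isZero (isZero_zero _)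
      exact h0.of_iso (e.toHomologyIso n)
    · intro h
      obtain ⟨c⟩ := contractible_of_acyclic hsplit K
        (fun n => (K.exactAt_iff_isZero_homology n).2 (h n))
      exact ⟨{ hom := 0, inv := 0
               homotopyHomInvId := (Homotopy.ofEq (by simp)).trans c.symm
               homotopyInvHomId := Homotopy.ofEq ((isZero_zero _).eq_of_src _ _) }⟩
end
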